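/- Let σ_n be a uniform random 231-avoiding permutation of size n. For every first-order sentence Ψ in the language with two binary relation symbols <_P and <_V, the probability P(σ_n ⊨ Ψ) = |{σ ∈ Av_n(231) : σ ⊨ Ψ}| / Cat_n converges to a limit as n → ∞. -/

import Mathlib

open FirstOrder Filter Asymptotics Topology

namespace Av231

/-- Relation symbols of the theory of two orders: two binary relations `<_P` and `<_V`. -/
inductive TwoRel : ℕ → Type
  | lp : TwoRel 2
  | lv : TwoRel 2

/-- The first-order language with two binary relation symbols `<_P` and `<_V`. -/
def L : Language := ⟨fun _ => Empty, TwoRel⟩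

/-- The `L`-structure on `Fin n` associated with a permutation `σ` of `{1,…,n}`:
`i <_P j` iff `i < j` and `i <_V j` iff `σ i < σ j`. -/
def pStruct {n : ℕ} (σ : Equiv.Perm (Fin n)) : L.Structure (Fin n) where
  funMap := fun f _ => nomatch f
  RelMap := fun r x =>
    match r with
    | .lp => x 0 < x 1
    | .lv => σ (x 0) < σ (x 1)

/-- A permutation satisfies a first-order sentence. -/
def Sat {n : ℕ} (σ : Equiv.Perm (Fin n)) (ψ : L.Sentence) : Prop :=
  @Language.Sentence.Realize L (Fin n) (pStruct σ) ψ

/-- The quantifier depth of a first-order formula. -/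
def qd {L' : Language} {α : Type*} : ∀ {n : ℕ}, L'.BoundedFormula α n → ℕ
  | _, .falsum => 0
  | _, .equal _ _ => 0
  | _, .rel _ _ => 0
  | _, .imp f g => max (qd f) (qd g)
  | _, .all f => qd f + 1

/-- A permutation avoids the pattern `231`. -/
def Avoids {n : ℕ} (σ : Equiv.Perm (Fin n)) : Prop :=
  ¬ ∃ i j k : Fin n, i < j ∧ j < k ∧ σ k < σ i ∧ σ i < σ j

/-- The number of `231`-avoiding permutations of size `n` satisfying `ψ`. -/
noncomputable def avN (n : ℕ) (ψ : L.Sentence) : ℕ :=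
  Nat.card {σ : Equiv.Perm (Fin n) // Avoids σ ∧ Sat σ ψ}

/-- The probability that a uniform random `231`-avoiding permutation of size `n`
satisfies `ψ` (the number of `231`-avoiding permutations of size `n` is `catalan n`). -/
noncomputable def prob (n : ℕ) (ψ : L.Sentence) : ℝ :=
  (avN n ψ : ℝ) / (catalan n : ℝ)

/-- Permutations of arbitrary finite size. -/
abbrev FinPerm := Σ n : ℕ, Equiv.Perm (Fin n)

def AvoidsF (p : FinPerm) : Prop := Avoids p.2

/-- Direct sum of permutations. -/
def dsum {a b : ℕ} (σ : Equiv.Perm (Fin a)) (τ : Equiv.Perm (Fin b)) :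
    Equiv.Perm (Fin (a + b)) :=
  finSumFinEquiv.permCongr (Equiv.sumCongr σ τ)

/-- Skew sum of permutations. -/
def ssum {a b : ℕ} (σ : Equiv.Perm (Fin a)) (τ : Equiv.Perm (Fin b)) :
    Equiv.Perm (Fin (a + b)) :=
  finSumFinEquiv.symm.trans ((Equiv.sumCongr σ τ).trans
    ((Equiv.sumComm (Fin a) (Fin b)).trans (finSumFinEquiv.trans (finCongr (Nat.add_comm b a)))))

/-- The operation `(τ, π) ↦ τ ⊕ (1 ⊖ π)` on permutations of arbitrary sizes. -/
def glue (τ π : FinPerm) : FinPerm :=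
  ⟨τ.1 + (1 + π.1), dsum τ.2 (ssum (1 : Equiv.Perm (Fin 1)) π.2)⟩

/-- Two permutations are `k`-equivalent when they satisfy the same first-order sentences
of quantifier depth at most `k`. -/
def kEquiv (k : ℕ) (p q : FinPerm) : Prop :=
  ∀ ψ : L.Sentence, qd ψ ≤ k → (Sat p.2 ψ ↔ Sat q.2 ψ)

section TreeDensities

open BinaryTree Finset

/-- The number of binary trees with `n` nodes lying in `U`. -/
noncomputable def treeCount (n : ℕ) (U : Set (BinaryTree Unit)) : ℕ :=
  open Classical in #{t ∈ treesOfNumNodesEq n | t ∈ U}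

/-- The proportion of binary trees with `n` nodes lying in `U`. -/
noncomputable def treeFreq (n : ℕ) (U : Set (BinaryTree Unit)) : ℝ :=
  treeCount n U / catalan n

/-- The lower density of a set of binary trees. -/
noncomputable def lowerDensity (U : Set (BinaryTree Unit)) : ℝ :=
  liminf (fun n => treeFreq n U) atTop

theorem catalan_pos (n : ℕ) : 0 < catalan n := by
  have h := succ_mul_catalan_eq_centralBinom n
  have h' := Nat.centralBinom_pos n
  exact Nat.pos_of_ne_zero fun h0 => by simp [h0] at h; omega

theorem treeCount_add_compl (n : ℕ) (U : Set (BinaryTree Unit)) :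
    treeCount n U + treeCount n Uᶜ = catalan n := by
  classical
  rw [← treesOfNumNodesEq_card_eq_catalan, treeCount, treeCount]
  convert Finset.card_filter_add_card_filter_not (s := treesOfNumNodesEq n) (· ∈ U)

theorem treeFreq_add_compl (n : ℕ) (U : Set (BinaryTree Unit)) :
    treeFreq n U + treeFreq n Uᶜ = 1 := by
  have h : (catalan n : ℝ) ≠ 0 := by exact_mod_cast (catalan_pos n).ne'
  rw [treeFreq, treeFreq, ← add_div, ← Nat.cast_add, treeCount_add_compl, div_self h]

theorem treeFreq_nonneg (n : ℕ) (U : Set (BinaryTree Unit)) : 0 ≤ treeFreq n U := by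
  unfold treeFreq; positivity

theorem treeFreq_le_one (n : ℕ) (U : Set (BinaryTree Unit)) : treeFreq n U ≤ 1 := by
  linarith [treeFreq_add_compl n U, treeFreq_nonneg n Uᶜ]

theorem eventually_lt_treeFreq {U : Set (BinaryTree Unit)} {a : ℝ} (h : a < lowerDensity U) :
    ∀ᶠ n in atTop, a < treeFreq n U :=
  eventually_lt_of_lt_liminf h
    (isBoundedUnder_of ⟨0, fun n => treeFreq_nonneg n U⟩)

theorem le_lowerDensity_of_tendsto {U : Set (BinaryTree Unit)} {g : ℕ → ℝ} {x : ℝ}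
    (hg : Tendsto g atTop (𝓝 x)) (h : ∀ᶠ n in atTop, g n ≤ treeFreq (n + 1) U) :
    x ≤ lowerDensity U := by
  rw [← hg.liminf_eq, lowerDensity, ← liminf_nat_add (fun n => treeFreq n U) 1]
  exact liminf_le_liminf h hg.isBoundedUnder_ge
    (isBoundedUnder_of ⟨1, fun n => treeFreq_le_one (n + 1) U⟩).isCoboundedUnder_ge

theorem lowerDensity_nonneg (U : Set (BinaryTree Unit)) : 0 ≤ lowerDensity U :=
  le_lowerDensity_of_tendsto tendsto_const_nhds (.of_forall fun n => treeFreq_nonneg (n + 1) U)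

theorem lowerDensity_univ : 1 ≤ lowerDensity .univ := by
  refine le_lowerDensity_of_tendsto tendsto_const_nhds (.of_forall fun n => ?_)
  have h := treeFreq_add_compl (n + 1) .univ
  have : treeFreq (n + 1) (Set.univᶜ) = 0 := by simp [treeFreq, treeCount]
  linarith

theorem tendsto_treeFreq_of_one_le {U : Set (BinaryTree Unit)}
    (h : 1 ≤ lowerDensity U + lowerDensity Uᶜ) :
    Tendsto (fun n => treeFreq n U) atTop (𝓝 (lowerDensity U)) := by
  refine tendsto_order.2 ⟨fun a ha => eventually_lt_treeFreq ha, fun a ha => ?_⟩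
  filter_upwards [eventually_lt_treeFreq (U := Uᶜ) (a := 1 - a) (by linarith)] with n hn
  linarith [treeFreq_add_compl n U]

theorem sum_treeCount_le (K n : ℕ) (hn : 2 * K ≤ n) (U : Set (BinaryTree Unit)) :
    ∑ s ∈ (range K).biUnion treesOfNumNodesEq, (treeCount (n - s.numNodes) {x | s △ x ∈ U} +
      treeCount (n - s.numNodes) {x | x △ s ∈ U}) ≤ treeCount (n + 1) U := by
  classical
  set S := (range K).biUnion treesOfNumNodesEq with hS
  have memS : ∀ s, s ∈ S ↔ s.numNodes < K := by intro s; simp [hS]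
  set A := S.sigma fun s => {x ∈ treesOfNumNodesEq (n - s.numNodes) | s △ x ∈ U} with hA
  set B := S.sigma fun s => {x ∈ treesOfNumNodesEq (n - s.numNodes) | x △ s ∈ U} with hB
  have h1 : ∑ s ∈ S, (treeCount (n - s.numNodes) {x | s △ x ∈ U} +
      treeCount (n - s.numNodes) {x | x △ s ∈ U}) =
      #(A.image fun p => p.1 △ p.2) + #(B.image fun p => p.2 △ p.1) := by
    rw [card_image_of_injective, card_image_of_injective, hA, hB, card_sigma, card_sigma,
      sum_add_distrib]
    · congr 1
    · rintro ⟨a, b⟩ ⟨c, d⟩ h; simp at h; simp [h]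
    · rintro ⟨a, b⟩ ⟨c, d⟩ h; simp at h; simp [h]
  rw [h1, ← card_union_of_disjoint, treeCount]
  · refine card_le_card fun t ht => ?_
    simp only [mem_union, Finset.mem_image, hA, hB, mem_sigma, memS, mem_filter,
      mem_treesOfNumNodesEq] at ht ⊢
    rcases ht with ⟨⟨s, x⟩, ⟨h1, h2, h3⟩, rfl⟩ | ⟨⟨s, x⟩, ⟨h1, h2, h3⟩, rfl⟩ <;>
      refine ⟨?_, h3⟩ <;> simp only [numNodes] at * <;> omega
  · rw [Finset.disjoint_left]
    intro t h h'
    simp only [Finset.mem_image, hA, hB, mem_sigma, memS, mem_filter,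
      mem_treesOfNumNodesEq] at h h'
    obtain ⟨⟨s, x⟩, ⟨h1, h2, h3⟩, rfl⟩ := h
    obtain ⟨⟨s', x'⟩, ⟨h1', h2', h3'⟩, h4⟩ := h'
    simp only [node.injEq, true_and] at h4
    obtain ⟨rfl, rfl⟩ := h4
    simp only at *
    omega

theorem catalan_succ_mul (n : ℕ) :
    ((n : ℝ) + 2) * catalan (n + 1) = 2 * (2 * n + 1) * catalan n := by
  have h1 := succ_mul_catalan_eq_centralBinom n
  have h2 := succ_mul_catalan_eq_centralBinom (n + 1)
  have h3 := Nat.succ_mul_centralBinom_succ n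
  have h1' : ((n : ℝ) + 1) * catalan n = n.centralBinom := by exact_mod_cast h1
  have h2' : ((n : ℝ) + 1 + 1) * catalan (n + 1) = (n + 1).centralBinom := by exact_mod_cast h2
  have h3' : ((n : ℝ) + 1) * (n + 1).centralBinom = 2 * (2 * n + 1) * n.centralBinom := by
    exact_mod_cast h3
  have : (n : ℝ) + 1 ≠ 0 := by positivity
  apply mul_left_cancel₀ this
  rw [← h1', ← h2'] at h3'
  linear_combination h3'

theorem tendsto_catalan_div_succ :
    Tendsto (fun n : ℕ => (catalan n : ℝ) / catalan (n + 1)) atTop (𝓝 (1 / 4)) := by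
  have h : ∀ n : ℕ, (catalan n : ℝ) / catalan (n + 1) = 1 / 4 + (3 / 4) / (2 * n + 1) := by
    intro n
    have := catalan_succ_mul n
    have h0 : (catalan (n + 1) : ℝ) ≠ 0 := by exact_mod_cast (catalan_pos _).ne'
    have h1 : (2 * (n : ℝ) + 1) ≠ 0 := by positivity
    field_simp
    linarith
  simp_rw [h]
  have : Tendsto (fun n : ℕ => (3 / 4 : ℝ) / (2 * n + 1)) atTop (𝓝 0) := by
    apply Tendsto.const_div_atTop
    apply tendsto_atTop_add_const_right
    exact tendsto_natCast_atTop_atTop.const_mul_atTop (by norm_num)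
  simpa only [add_zero] using this.const_add (1 / 4)

theorem tendsto_catalan_div_add (m : ℕ) :
    Tendsto (fun n : ℕ => (catalan n : ℝ) / catalan (n + m)) atTop (𝓝 ((1 / 4) ^ m)) := by
  induction m with
  | zero =>
    have : ∀ n : ℕ, (catalan n : ℝ) / catalan (n + 0) = 1 := fun n =>
      div_self (by exact_mod_cast (catalan_pos n).ne')
    simp_rw [this]; simp
  | succ m ih =>
    have := ih.mul ((tendsto_add_atTop_iff_nat m).2 tendsto_catalan_div_succ)
    rw [← pow_succ] at this
    refine this.congr fun n => ?_
    have h0 : (catalan (n + m) : ℝ) ≠ 0 := by exact_mod_cast (catalan_pos _).ne'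
    rw [div_mul_div_cancel₀ h0, add_assoc]

theorem tendsto_catalan_sub_div (m : ℕ) :
    Tendsto (fun n : ℕ => (catalan (n - m) : ℝ) / catalan (n + 1)) atTop
      (𝓝 ((1 / 4) ^ (m + 1))) := by
  refine ((tendsto_catalan_div_add (m + 1)).comp (tendsto_sub_atTop_nat m)).congr' ?_
  filter_upwards [eventually_ge_atTop m] with n hn
  simp only [Function.comp]
  rw [show n - m + (m + 1) = n + 1 by omega]

theorem sum_catalan_eq (K : ℕ) :
    ∑ i ∈ range K, (catalan i : ℝ) * (1 / 4) ^ (i + 1) =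
      1 / 2 - 1 / 2 * (K.centralBinom / 4 ^ K) := by
  induction K with
  | zero => simp
  | succ K ih =>
    rw [sum_range_succ, ih]
    have h1 := succ_mul_catalan_eq_centralBinom K
    have h3 := Nat.succ_mul_centralBinom_succ K
    have h1' : ((K : ℝ) + 1) * catalan K = K.centralBinom := by exact_mod_cast h1
    have h3' : ((K : ℝ) + 1) * (K + 1).centralBinom = 2 * (2 * K + 1) * K.centralBinom := by
      exact_mod_cast h3
    have h0 : (K : ℝ) + 1 ≠ 0 := by positivity
    have h2 : ((K + 1).centralBinom : ℝ) = 2 * (2 * K + 1) * catalan K := by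
      apply mul_left_cancel₀ h0
      rw [h3', ← h1']; ring
    rw [h2, ← h1']
    simp only [one_div, inv_pow, pow_succ]
    field_simp
    ring

theorem tendsto_centralBinom_div :
    Tendsto (fun K : ℕ => (K.centralBinom : ℝ) / 4 ^ K) atTop (𝓝 0) := by
  have key : ∀ K : ℕ, ((K.centralBinom : ℝ) / 4 ^ K) ^ 2 * (2 * K + 1) ≤ 1 := by
    intro K
    induction K with
    | zero => simp
    | succ K ih =>
      have h3' : ((K : ℝ) + 1) * (K + 1).centralBinom = 2 * (2 * K + 1) * K.centralBinom := by
        exact_mod_cast Nat.succ_mul_centralBinom_succ K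
      have h0 : (K : ℝ) + 1 ≠ 0 := by positivity
      have h2 : ((K + 1).centralBinom : ℝ) / 4 ^ (K + 1) =
          (K.centralBinom / 4 ^ K) * ((2 * K + 1) / (2 * (K + 1))) := by
        rw [pow_succ]; field_simp; linarith
      rw [h2]
      set a := (K.centralBinom : ℝ) / 4 ^ K
      push_cast
      calc _ = (a ^ 2 * (2 * K + 1)) * ((2 * K + 1) * (2 * (K + 1) + 1) / (2 * (K + 1)) ^ 2) := by
            field_simp
        _ ≤ 1 * 1 := by
            gcongr
            rw [div_le_one (by positivity)]
            nlinarith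
        _ = 1 := one_mul 1
  have h : Tendsto (fun K : ℕ => ((K.centralBinom : ℝ) / 4 ^ K) ^ 2) atTop (𝓝 0) := by
    refine squeeze_zero (g := fun K : ℕ => 1 / (2 * (K : ℝ) + 1)) (fun K => by positivity)
      (fun K => ?_) ?_
    · rw [le_div_iff₀ (by positivity)]; exact key K
    · apply Tendsto.const_div_atTop
      apply tendsto_atTop_add_const_right
      exact tendsto_natCast_atTop_atTop.const_mul_atTop (by norm_num)
  have := h.sqrt
  simpa [Real.sqrt_sq (div_nonneg (Nat.cast_nonneg _) (by positivity : (0 : ℝ) ≤ 4 ^ _))] using this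

theorem tendsto_sum_small_trees :
    Tendsto (fun K : ℕ => ∑ s ∈ (range K).biUnion treesOfNumNodesEq,
      (1 / 4 : ℝ) ^ (s.numNodes + 1)) atTop (𝓝 (1 / 2)) := by
  classical
  have h : ∀ K : ℕ, ∑ s ∈ (range K).biUnion treesOfNumNodesEq, (1 / 4 : ℝ) ^ (s.numNodes + 1) =
      1 / 2 - 1 / 2 * (K.centralBinom / 4 ^ K) := by
    intro K
    rw [← sum_catalan_eq, sum_biUnion]
    · refine sum_congr rfl fun i _ => ?_
      rw [← treesOfNumNodesEq_card_eq_catalan, ← nsmul_eq_mul]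
      exact sum_eq_card_nsmul fun s hs => by rw [mem_treesOfNumNodesEq.1 hs]
    · intro i _ j _ hij
      simp only [Function.onFun, Finset.disjoint_left, mem_treesOfNumNodesEq]
      rintro t rfl; exact hij
  simp_rw [h]
  simpa only [mul_zero, sub_zero] using (tendsto_centralBinom_div.const_mul (1 / 2)).const_sub (1 / 2)

theorem sum_lowerDensity_le (K : ℕ) (U : Set (BinaryTree Unit)) :
    ∑ s ∈ (range K).biUnion treesOfNumNodesEq, (1 / 4 : ℝ) ^ (s.numNodes + 1) *
      (lowerDensity {x | s △ x ∈ U} + lowerDensity {x | x △ s ∈ U}) ≤ lowerDensity U := by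
  set S := (range K).biUnion treesOfNumNodesEq with hS
  have step : ∀ ε > 0, ∑ s ∈ S, (1 / 4 : ℝ) ^ (s.numNodes + 1) *
      (lowerDensity {x | s △ x ∈ U} - ε + (lowerDensity {x | x △ s ∈ U} - ε)) ≤
      lowerDensity U := by
    intro ε hε
    have hlim : Tendsto (fun n : ℕ => ∑ s ∈ S,
        ((catalan (n - s.numNodes) : ℝ) / catalan (n + 1)) *
        (lowerDensity {x | s △ x ∈ U} - ε + (lowerDensity {x | x △ s ∈ U} - ε))) atTop
        (𝓝 (∑ s ∈ S, (1 / 4 : ℝ) ^ (s.numNodes + 1) *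
          (lowerDensity {x | s △ x ∈ U} - ε + (lowerDensity {x | x △ s ∈ U} - ε)))) :=
      tendsto_finsetSum _ fun s _ => (tendsto_catalan_sub_div s.numNodes).mul_const _
    refine le_lowerDensity_of_tendsto hlim ?_
    have hev : ∀ᶠ n in atTop, ∀ s ∈ S,
        lowerDensity {x | s △ x ∈ U} - ε < treeFreq (n - s.numNodes) {x | s △ x ∈ U} ∧
        lowerDensity {x | x △ s ∈ U} - ε < treeFreq (n - s.numNodes) {x | x △ s ∈ U} := by
      rw [eventually_all_finset]
      intro s _
      exact (tendsto_sub_atTop_nat s.numNodes).eventually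
        ((eventually_lt_treeFreq (by linarith)).and (eventually_lt_treeFreq (by linarith)))
    filter_upwards [hev, eventually_ge_atTop (2 * K)] with n hn hK
    have hpos : (0 : ℝ) < catalan (n + 1) := by exact_mod_cast catalan_pos _
    calc _ ≤ ∑ s ∈ S, ((catalan (n - s.numNodes) : ℝ) / catalan (n + 1)) *
          (treeFreq (n - s.numNodes) {x | s △ x ∈ U} +
            treeFreq (n - s.numNodes) {x | x △ s ∈ U}) := by
          refine sum_le_sum fun s hs => ?_
          obtain ⟨h1, h2⟩ := hn s hs
          gcongr
      _ = ((∑ s ∈ S, (treeCount (n - s.numNodes) {x | s △ x ∈ U} +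
            treeCount (n - s.numNodes) {x | x △ s ∈ U}) : ℕ) : ℝ) / catalan (n + 1) := by
          push_cast
          rw [sum_div]
          refine sum_congr rfl fun s _ => ?_
          have : (catalan (n - s.numNodes) : ℝ) ≠ 0 := by exact_mod_cast (catalan_pos _).ne'
          rw [treeFreq, treeFreq]
          field_simp
      _ ≤ treeFreq (n + 1) U := by
          rw [treeFreq]
          gcongr
          exact sum_treeCount_le K n hK U
  have hlim : Tendsto (fun ε : ℝ => ∑ s ∈ S, (1 / 4 : ℝ) ^ (s.numNodes + 1) *
      (lowerDensity {x | s △ x ∈ U} - ε + (lowerDensity {x | x △ s ∈ U} - ε))) (𝓝[>] 0)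
      (𝓝 (∑ s ∈ S, (1 / 4 : ℝ) ^ (s.numNodes + 1) *
      (lowerDensity {x | s △ x ∈ U} - 0 + (lowerDensity {x | x △ s ∈ U} - 0)))) :=
    (Continuous.tendsto (by fun_prop) 0).mono_left nhdsWithin_le_nhds
  simp only [sub_zero] at hlim
  exact le_of_tendsto hlim (eventually_mem_nhdsWithin.mono fun ε hε => step ε hε)

/-- One minus the oscillation of the frequencies of `U`. -/
noncomputable def concentration (U : Set (BinaryTree Unit)) : ℝ :=
  lowerDensity U + lowerDensity Uᶜ

theorem sum_concentration_le (K : ℕ) (U : Set (BinaryTree Unit)) :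
    ∑ s ∈ (range K).biUnion treesOfNumNodesEq, (1 / 4 : ℝ) ^ (s.numNodes + 1) *
      (concentration {x | s △ x ∈ U} + concentration {x | x △ s ∈ U}) ≤ concentration U := by
  refine le_trans (le_of_eq ?_) (add_le_add (sum_lowerDensity_le K U) (sum_lowerDensity_le K Uᶜ))
  rw [← sum_add_distrib]
  refine sum_congr rfl fun s _ => ?_
  simp only [concentration, Set.compl_def, Set.mem_ofPred_eq]
  ring

theorem concentration_pullback_le {U : Set (BinaryTree Unit)}
    (hl : ∀ s, concentration U ≤ concentration {x | s △ x ∈ U})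
    (hr : ∀ s, concentration U ≤ concentration {x | x △ s ∈ U}) (s : BinaryTree Unit) :
    concentration {x | s △ x ∈ U} ≤ concentration U ∧
      concentration {x | x △ s ∈ U} ≤ concentration U := by
  classical
  set b := concentration U
  have hw : (0 : ℝ) < (1 / 4) ^ (s.numNodes + 1) := by positivity
  set e := (1 / 4 : ℝ) ^ (s.numNodes + 1) *
    ((concentration {x | s △ x ∈ U} - b) + (concentration {x | x △ s ∈ U} - b)) with he
  have main : ∀ᶠ K : ℕ in atTop, (∑ t ∈ (range K).biUnion treesOfNumNodesEq,
      (1 / 4 : ℝ) ^ (t.numNodes + 1)) * (2 * b) + e ≤ b := by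
    filter_upwards [eventually_gt_atTop s.numNodes] with K hK
    have hs : s ∈ (range K).biUnion treesOfNumNodesEq := by simp [hK]
    have h1 : e ≤ ∑ t ∈ (range K).biUnion treesOfNumNodesEq, (1 / 4 : ℝ) ^ (t.numNodes + 1) *
        ((concentration {x | t △ x ∈ U} - b) + (concentration {x | x △ t ∈ U} - b)) :=
      single_le_sum (f := fun t : BinaryTree Unit => (1 / 4 : ℝ) ^ (t.numNodes + 1) *
        ((concentration {x | t △ x ∈ U} - b) + (concentration {x | x △ t ∈ U} - b)))
        (fun t _ => mul_nonneg (by positivity)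
          (add_nonneg (sub_nonneg.2 (hl t)) (sub_nonneg.2 (hr t)))) hs
    refine le_trans (add_le_add_right h1 _) (le_trans (le_of_eq ?_) (sum_concentration_le K U))
    rw [sum_mul, ← sum_add_distrib]
    refine sum_congr rfl fun t _ => ?_
    ring
  have hlim := (tendsto_sum_small_trees.mul_const (2 * b)).add_const e
  have h0 : e ≤ 0 := by linarith [le_of_tendsto hlim main]
  have h1 : (concentration {x | s △ x ∈ U} - b) + (concentration {x | x △ s ∈ U} - b) ≤ 0 := by
    by_contra h
    exact absurd h0 (not_le.2 (mul_pos hw (not_le.1 h)))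
  constructor <;> linarith [hl s, hr s]

/-- Concatenation of binary trees along the left spine of the second one. -/
def graft (x : BinaryTree Unit) : BinaryTree Unit → BinaryTree Unit
  | .nil => x
  | .node _ l r => graft x l △ r

/-- A finite family of sets of trees that is stable under pulling back along one-hole contexts
and admits a context on which all its members are constant satisfies a convergence law. -/
theorem exists_tendsto_treeFreq {F : Set (Set (BinaryTree Unit))} (hF : F.Finite)
    (hl : ∀ U ∈ F, ∀ s, {x | s △ x ∈ U} ∈ F) (hr : ∀ U ∈ F, ∀ s, {x | x △ s ∈ U} ∈ F)
    {e : BinaryTree Unit}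
    (he : ∀ U ∈ F, ∀ x y, graft (e △ x) e ∈ U → graft (e △ y) e ∈ U)
    {U : Set (BinaryTree Unit)} (hU : U ∈ F) :
    ∃ l, Tendsto (fun n => treeFreq n U) atTop (𝓝 l) := by
  obtain ⟨V, hV, hmin⟩ := hF.exists_minimalFor concentration F ⟨U, hU⟩
  have hmin' : ∀ W ∈ F, concentration V ≤ concentration W := fun W hW =>
    (le_total (concentration V) (concentration W)).elim id (hmin hW)
  let G : Set (Set (BinaryTree Unit)) := {W ∈ F | concentration W = concentration V}
  have hG : ∀ W ∈ G, ∀ s, {x | s △ x ∈ W} ∈ G ∧ {x | x △ s ∈ W} ∈ G := by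
    rintro W ⟨hW, hWV⟩ s
    have := concentration_pullback_le (U := W) (fun s => hWV ▸ hmin' _ (hl W hW s))
      (fun s => hWV ▸ hmin' _ (hr W hW s)) s
    exact ⟨⟨hl W hW s, le_antisymm (hWV ▸ this.1) (hmin' _ (hl W hW s))⟩,
      ⟨hr W hW s, le_antisymm (hWV ▸ this.2) (hmin' _ (hr W hW s))⟩⟩
  have hgraft : ∀ t : BinaryTree Unit, ∀ W ∈ G, {x | graft x t ∈ W} ∈ G := by
    intro t
    induction t using BinaryTree.unitRecOn with
    | base => intro W hW; exact hW
    | ind l r ihl _ => intro W hW; exact ihl _ (hG W hW r).2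
  have hW := (hG _ (hgraft e V ⟨hV, rfl⟩) e).1
  have hone : 1 ≤ concentration V := by
    rw [← hW.2, concentration]
    by_cases h : ∃ x, graft (e △ x) e ∈ V
    · obtain ⟨x, hx⟩ := h
      have : {x | e △ x ∈ {x | graft x e ∈ V}} = .univ :=
        Set.eq_univ_of_forall fun y => he V hV x y hx
      rw [this]
      linarith [lowerDensity_univ, lowerDensity_nonneg (Set.univᶜ)]
    · have : {x | e △ x ∈ {x | graft x e ∈ V}} = ∅ :=
        Set.eq_empty_of_forall_notMem fun y hy => h ⟨y, hy⟩
      rw [this, Set.compl_empty]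
      linarith [lowerDensity_univ, lowerDensity_nonneg ∅]
  exact ⟨_, tendsto_treeFreq_of_one_le (hone.trans (hmin' U hU))⟩

end TreeDensities

section Permutations

/-- One-line notation of a permutation, extended by zero. -/
def val (p : FinPerm) (i : ℕ) : ℕ := if h : i < p.1 then p.2 ⟨i, h⟩ else 0

theorem val_of_lt {p : FinPerm} {i : ℕ} (h : i < p.1) : val p i = p.2 ⟨i, h⟩ := dif_pos h

theorem val_lt {p : FinPerm} {i : ℕ} (h : i < p.1) : val p i < p.1 := by
  rw [val_of_lt h]; exact (p.2 _).isLt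

theorem val_inj {p : FinPerm} {i j : ℕ} (hi : i < p.1) (hj : j < p.1) :
    val p i = val p j ↔ i = j := by
  rw [val_of_lt hi, val_of_lt hj, Fin.val_inj, p.2.injective.eq_iff, Fin.mk.injEq]

theorem finPerm_ext {p q : FinPerm} (h : p.1 = q.1) (h' : ∀ i < p.1, val p i = val q i) :
    p = q := by
  obtain ⟨n, σ⟩ := p
  obtain ⟨m, τ⟩ := q
  obtain rfl : n = m := h
  congr 1
  ext i
  have := h' i i.isLt
  rwa [val_of_lt (p := ⟨n, σ⟩) i.isLt, val_of_lt (p := ⟨n, τ⟩) i.isLt] at this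

/-- Skew sum of permutations of arbitrary sizes. -/
def skew (p q : FinPerm) : FinPerm := ⟨p.1 + q.1, ssum p.2 q.2⟩

instance : Mul FinPerm := ⟨fun p q => ⟨p.1 + q.1, dsum p.2 q.2⟩⟩

instance : One FinPerm := ⟨⟨0, 1⟩⟩

@[simp] theorem one_fst : (1 : FinPerm).1 = 0 := rfl

@[simp] theorem mul_fst (p q : FinPerm) : (p * q).1 = p.1 + q.1 := rfl

@[simp] theorem skew_fst (p q : FinPerm) : (skew p q).1 = p.1 + q.1 := rfl

theorem val_mul_left {p : FinPerm} (q : FinPerm) {i : ℕ} (h : i < p.1) :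
    val (p * q) i = val p i := by
  rw [val_of_lt h, val_of_lt (show i < (p * q).1 by simp; omega)]
  have : (⟨i, by omega⟩ : Fin (p.1 + q.1)) = finSumFinEquiv (Sum.inl ⟨i, h⟩) := rfl
  change ((dsum p.2 q.2 ⟨i, _⟩ : Fin _) : ℕ) = _
  rw [this, dsum, Equiv.permCongr_apply, Equiv.symm_apply_apply]
  rfl

theorem val_mul_right (p : FinPerm) {q : FinPerm} {i : ℕ} (h : i < q.1) :
    val (p * q) (p.1 + i) = p.1 + val q i := by
  rw [val_of_lt h, val_of_lt (show p.1 + i < (p * q).1 by simp; omega)]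
  have : (⟨p.1 + i, by omega⟩ : Fin (p.1 + q.1)) = finSumFinEquiv (Sum.inr ⟨i, h⟩) := rfl
  change ((dsum p.2 q.2 ⟨p.1 + i, _⟩ : Fin _) : ℕ) = _
  rw [this, dsum, Equiv.permCongr_apply, Equiv.symm_apply_apply]
  rfl

theorem val_skew_left {p : FinPerm} (q : FinPerm) {i : ℕ} (h : i < p.1) :
    val (skew p q) i = q.1 + val p i := by
  rw [val_of_lt h, val_of_lt (show i < (skew p q).1 by simp; omega)]
  have : (⟨i, by omega⟩ : Fin (p.1 + q.1)) = finSumFinEquiv (Sum.inl ⟨i, h⟩) := rfl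
  change ((ssum p.2 q.2 ⟨i, _⟩ : Fin _) : ℕ) = _
  rw [this, ssum, Equiv.trans_apply, Equiv.symm_apply_apply]
  rfl

theorem val_skew_right (p : FinPerm) {q : FinPerm} {i : ℕ} (h : i < q.1) :
    val (skew p q) (p.1 + i) = val q i := by
  rw [val_of_lt h, val_of_lt (show p.1 + i < (skew p q).1 by simp; omega)]
  have : (⟨p.1 + i, by omega⟩ : Fin (p.1 + q.1)) = finSumFinEquiv (Sum.inr ⟨i, h⟩) := rfl
  change ((ssum p.2 q.2 ⟨p.1 + i, _⟩ : Fin _) : ℕ) = _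
  rw [this, ssum, Equiv.trans_apply, Equiv.symm_apply_apply]
  rfl

instance : Monoid FinPerm where
  mul_assoc p q r := by
    refine finPerm_ext (by simp [add_assoc]) fun i hi => ?_
    simp only [mul_fst] at hi
    rcases lt_or_ge i (p.1 + q.1) with h | h
    · rw [val_mul_left (p := p * q) r h]
      rcases lt_or_ge i p.1 with h' | h'
      · rw [val_mul_left _ h', val_mul_left _ h']
      · obtain ⟨j, rfl⟩ := Nat.exists_eq_add_of_le h'
        have hj : j < q.1 := by omega
        rw [val_mul_right _ hj, val_mul_right _ (show j < (q * r).1 by simp; omega),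
          val_mul_left _ hj]
    · obtain ⟨j, rfl⟩ := Nat.exists_eq_add_of_le h
      have hj : j < r.1 := by omega
      have h1 := val_mul_right (p * q) hj
      have h2 := val_mul_right p (q := q * r) (i := q.1 + j) (by simp; omega)
      rw [val_mul_right q hj] at h2
      simp only [mul_fst] at h1
      rw [h1, add_assoc, add_assoc, h2]
  one_mul p := by
    refine finPerm_ext (by simp) fun i hi => ?_
    have := val_mul_right 1 (q := p) (i := i) (by simpa using hi)
    simpa using this
  mul_one p := finPerm_ext (by simp) fun i hi => val_mul_left 1 (by simpa using hi)

theorem glue_eq (p q : FinPerm) : glue p q = p * skew ⟨1, 1⟩ q := rfl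

theorem glue_fst (p q : FinPerm) : (glue p q).1 = p.1 + q.1 + 1 := by
  simp [glue]; omega

theorem val_glue_left {p : FinPerm} (q : FinPerm) {i : ℕ} (h : i < p.1) :
    val (glue p q) i = val p i := by
  rw [glue_eq, val_mul_left _ h]

theorem val_glue_mid (p q : FinPerm) : val (glue p q) p.1 = p.1 + q.1 := by
  have h := val_mul_right p (q := skew ⟨1, 1⟩ q) (i := 0) (by simp)
  rw [val_skew_left q (by simp)] at h
  have h1 : val ⟨1, 1⟩ 0 = 0 := rfl
  rw [h1] at h
  exact h

theorem val_glue_right (p : FinPerm) {q : FinPerm} {i : ℕ} (h : i < q.1) :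
    val (glue p q) (p.1 + 1 + i) = p.1 + val q i := by
  have h1 := val_mul_right p (q := skew ⟨1, 1⟩ q) (i := 1 + i) (by simpa using h)
  rw [val_skew_right ⟨1, 1⟩ h, ← add_assoc] at h1
  exact h1

theorem avoidsF_iff (p : FinPerm) : AvoidsF p ↔
    ∀ i j k, i < j → j < k → k < p.1 → val p k < val p i → val p i < val p j → False := by
  constructor
  · intro h i j k hij hjk hk h1 h2
    refine h ⟨⟨i, by omega⟩, ⟨j, by omega⟩, ⟨k, hk⟩, hij, hjk, ?_, ?_⟩
    · rwa [val_of_lt hk, val_of_lt (by omega)] at h1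
    · rwa [val_of_lt (by omega), val_of_lt (by omega)] at h2
  · rintro h ⟨i, j, k, hij, hjk, h1, h2⟩
    refine h i j k hij hjk k.isLt ?_ ?_
    · rw [val_of_lt k.isLt, val_of_lt i.isLt]; exact h1
    · rw [val_of_lt j.isLt, val_of_lt i.isLt]; exact h2

theorem avoidsF_glue {p q : FinPerm} (hp : AvoidsF p) (hq : AvoidsF q) : AvoidsF (glue p q) := by
  rw [avoidsF_iff] at *
  intro i j k hij hjk hk h1 h2
  rw [glue_fst] at hk
  have low : ∀ x, x < p.1 → val (glue p q) x < p.1 := fun x hx => by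
    rw [val_glue_left q hx]; exact val_lt hx
  have high : ∀ x, p.1 ≤ x → x < p.1 + q.1 + 1 → p.1 ≤ val (glue p q) x := fun x hx hx' => by
    rcases hx.eq_or_lt with rfl | hx
    · rw [val_glue_mid]; omega
    · obtain ⟨y, rfl⟩ := Nat.exists_eq_add_of_le hx
      rw [Nat.succ_eq_add_one, val_glue_right p (by omega)]; omega
  rcases lt_or_ge k p.1 with hk' | hk'
  · rw [val_glue_left q hk', val_glue_left q (by omega)] at h1
    rw [val_glue_left q (by omega), val_glue_left q (by omega)] at h2
    exact hp i j k hij hjk hk' h1 h2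
  have h3 := high k hk' hk
  rcases lt_or_ge i p.1 with hi | hi
  · have := low i hi; omega
  obtain ⟨y, rfl⟩ := Nat.exists_eq_add_of_le (show p.1 + 1 ≤ j by omega)
  rw [val_glue_right p (by omega)] at h2
  rcases hi.eq_or_lt with rfl | hi
  · rw [val_glue_mid] at h2
    have := val_lt (p := q) (i := y) (by omega)
    omega
  obtain ⟨x, rfl⟩ := Nat.exists_eq_add_of_le (show p.1 + 1 ≤ i by omega)
  obtain ⟨z, rfl⟩ := Nat.exists_eq_add_of_le (show p.1 + 1 ≤ k by omega)
  rw [val_glue_right p (by omega)] at h1 h2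
  rw [val_glue_right p (by omega)] at h1
  exact hq x y z (by omega) (by omega) (by omega) (by omega) (by omega)

theorem glue_injective {p q p' q' : FinPerm} (h : glue p q = glue p' q') : p = p' ∧ q = q' := by
  have hs : p.1 + q.1 = p'.1 + q'.1 := by
    have := congrArg Sigma.fst h
    rw [glue_fst, glue_fst] at this
    omega
  have h1 : p.1 = p'.1 := by
    have h2 := val_glue_mid p q
    rw [hs, ← val_glue_mid p' q', h, val_inj (by rw [glue_fst]; omega)
      (by rw [glue_fst]; omega)] at h2
    exact h2
  refine ⟨finPerm_ext h1 fun i hi => ?_, finPerm_ext (by omega) fun i hi => ?_⟩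
  · rw [← val_glue_left q hi, h, val_glue_left q' (h1 ▸ hi)]
  · have h2 := val_glue_right p hi
    rw [h, h1, val_glue_right p' (by omega)] at h2
    omega

/-- A permutation given by an injective self-map of an initial segment. -/
theorem exists_finPerm_val (n : ℕ) (f : ℕ → ℕ) (hf : ∀ i < n, f i < n)
    (hinj : ∀ i < n, ∀ j < n, f i = f j → i = j) :
    ∃ p : FinPerm, p.1 = n ∧ ∀ i < n, val p i = f i := by
  let g : Fin n → Fin n := fun i => ⟨f i, hf i i.isLt⟩
  have hg : Function.Injective g := fun i j h =>
    Fin.ext (hinj i i.isLt j j.isLt (by simpa [g] using h))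
  exact ⟨⟨n, Equiv.ofBijective g (Finite.injective_iff_bijective.1 hg)⟩, rfl,
    fun i hi => by rw [val_of_lt hi]; rfl⟩

theorem exists_val_eq (p : FinPerm) {v : ℕ} (hv : v < p.1) : ∃ i < p.1, val p i = v :=
  ⟨p.2.symm ⟨v, hv⟩, Fin.isLt _, by rw [val_of_lt (Fin.isLt _)]; simp⟩

theorem exists_eq_glue {p : FinPerm} (hp : AvoidsF p) {n : ℕ} (hn : p.1 = n + 1) :
    ∃ l r, AvoidsF l ∧ AvoidsF r ∧ p = glue l r := by
  rw [avoidsF_iff] at hp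
  obtain ⟨a, ha, hva⟩ := exists_val_eq p (v := n) (by omega)
  have hne : ∀ x < p.1, x ≠ a → val p x < n := fun x hx hxa => by
    have h1 := val_lt hx
    have h2 : val p x ≠ n := fun h => hxa ((val_inj hx ha).1 (h.trans hva.symm))
    omega
  have hlt : ∀ i k, i < a → a < k → k < p.1 → val p i < val p k := fun i k hi hk hk' => by
    by_contra h
    have h1 : val p k ≠ val p i := fun h => by
      have := (val_inj hk' (by omega)).1 h; omega
    exact hp i a k hi hk hk' (by omega) (by have := hne i (by omega) (by omega); omega)
  have hlow : ∀ i < a, val p i < a := fun i hi => by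
    have hsub : (Finset.Ioo a p.1).image (val p) ⊆ Finset.Ioo (val p i) n := fun v hv => by
      obtain ⟨k, hk, rfl⟩ := Finset.mem_image.1 hv
      rw [Finset.mem_Ioo] at hk ⊢
      exact ⟨hlt i k hi hk.1 hk.2, hne k hk.2 (by omega)⟩
    have hc := Finset.card_le_card hsub
    rw [Finset.card_image_of_injOn, Nat.card_Ioo, Nat.card_Ioo] at hc
    · have := hne i (by omega) (by omega); omega
    · intro x hx y hy h
      simp only [Finset.coe_Ioo, Set.mem_Ioo] at hx hy
      exact (val_inj hx.2 hy.2).1 h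
  have hhigh : ∀ k, a < k → k < p.1 → a ≤ val p k := fun k hk hk' => by
    have hsub : (Finset.range a).image (val p) ⊆ Finset.range (val p k) := fun v hv => by
      obtain ⟨i, hi, rfl⟩ := Finset.mem_image.1 hv
      rw [Finset.mem_range] at hi ⊢
      exact hlt i k hi hk hk'
    have hc := Finset.card_le_card hsub
    rw [Finset.card_image_of_injOn, Finset.card_range, Finset.card_range] at hc
    · exact hc
    · intro x hx y hy h
      simp only [Finset.coe_range, Set.mem_Iio] at hx hy
      exact (val_inj (by omega) (by omega)).1 h
  obtain ⟨l, hl, hlv⟩ := exists_finPerm_val a (val p) hlow fun i hi j hj h =>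
    (val_inj (by omega) (by omega)).1 h
  obtain ⟨r, hr, hrv⟩ := exists_finPerm_val (n - a) (fun i => val p (a + 1 + i) - a)
    (fun i hi => by
      have h1 := hne (a + 1 + i) (by omega) (by omega)
      have h2 := hhigh (a + 1 + i) (by omega) (by omega)
      omega)
    fun i hi j hj h => by
      have h1 := hhigh (a + 1 + i) (by omega) (by omega)
      have h2 := hhigh (a + 1 + j) (by omega) (by omega)
      have := (val_inj (p := p) (i := a + 1 + i) (j := a + 1 + j) (by omega) (by omega)).1
        (by omega)
      omega
  refine ⟨l, r, ?_, ?_, finPerm_ext (by rw [glue_fst]; omega) fun i hi => ?_⟩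
  · rw [avoidsF_iff]
    intro i j k hij hjk hk h1 h2
    rw [hlv k (by omega), hlv i (by omega)] at h1
    rw [hlv i (by omega), hlv j (by omega)] at h2
    exact hp i j k hij hjk (by omega) h1 h2
  · rw [avoidsF_iff]
    intro i j k hij hjk hk h1 h2
    rw [hrv k (by omega), hrv i (by omega)] at h1
    rw [hrv i (by omega), hrv j (by omega)] at h2
    exact hp (a + 1 + i) (a + 1 + j) (a + 1 + k) (by omega) (by omega) (by omega)
      (by omega) (by omega)
  · rcases lt_trichotomy i a with h | rfl | h
    · rw [val_glue_left r (by omega), hlv i h]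
    · have := val_glue_mid l r
      rw [hl] at this
      omega
    · obtain ⟨j, rfl⟩ := Nat.exists_eq_add_of_le (show a + 1 ≤ i by omega)
      have h1 := val_glue_right l (q := r) (i := j) (by omega)
      rw [hl, hrv j (by omega)] at h1
      have := hhigh (a + 1 + j) (by omega) (by omega)
      omega

/-- The `231`-avoiding permutation encoded by a binary tree. -/
def toPerm : BinaryTree Unit → FinPerm
  | .nil => 1
  | .node _ l r => glue (toPerm l) (toPerm r)

theorem toPerm_fst (t : BinaryTree Unit) : (toPerm t).1 = t.numNodes := by
  induction t with
  | nil => rfl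
  | node _ l r hl hr => rw [toPerm, glue_fst, hl, hr, BinaryTree.numNodes]

theorem avoidsF_toPerm (t : BinaryTree Unit) : AvoidsF (toPerm t) := by
  induction t with
  | nil => rw [avoidsF_iff]; intro i j k _ _ h; simp [toPerm] at h
  | node _ l r hl hr => exact avoidsF_glue hl hr

theorem toPerm_injective : Function.Injective toPerm := by
  intro s
  induction s with
  | nil =>
    rintro (_ | ⟨_, l, r⟩) h
    · rfl
    · have := congrArg Sigma.fst h
      rw [toPerm_fst, toPerm_fst] at this
      simp [BinaryTree.numNodes] at this
  | node _ l r hl hr =>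
    rintro (_ | ⟨_, l', r'⟩) h
    · have := congrArg Sigma.fst h
      rw [toPerm_fst, toPerm_fst] at this
      simp [BinaryTree.numNodes] at this
    · obtain ⟨h1, h2⟩ := glue_injective h
      rw [hl h1, hr h2]

theorem exists_toPerm_eq {p : FinPerm} (hp : AvoidsF p) : ∃ t, toPerm t = p := by
  induction hn : p.1 using Nat.strong_induction_on generalizing p with
  | _ n ih =>
    rcases n with _ | n
    · exact ⟨.nil, finPerm_ext (by rw [hn]; rfl) fun i hi => absurd hi (by simp [toPerm])⟩
    · obtain ⟨l, r, hl, hr, rfl⟩ := exists_eq_glue hp hn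
      rw [glue_fst] at hn
      obtain ⟨s, rfl⟩ := ih l.1 (by omega) hl rfl
      obtain ⟨t, rfl⟩ := ih r.1 (by omega) hr rfl
      exact ⟨.node () s t, rfl⟩

theorem avN_eq_treeCount (n : ℕ) (ψ : L.Sentence) :
    avN n ψ = treeCount n {t | Sat (toPerm t).2 ψ} := by
  classical
  rw [avN, treeCount, ← Nat.card_eq_finsetCard]
  refine (Nat.card_congr (Equiv.ofBijective (fun t => ?_) ⟨?_, ?_⟩)).symm
  · have ht := Finset.mem_filter.1 t.2
    have hn : (toPerm t.1).1 = n :=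
      (toPerm_fst _).trans (BinaryTree.mem_treesOfNumNodesEq.1 ht.1)
    exact ⟨hn ▸ (toPerm t.1).2, by
      have h1 := avoidsF_toPerm t.1
      have h2 : Sat (toPerm t.1).2 ψ := ht.2
      revert h1 h2
      generalize toPerm t.1 = p at hn
      subst hn
      exact fun h1 h2 => ⟨h1, h2⟩⟩
  · rintro ⟨s, hs⟩ ⟨t, ht⟩ h
    have hs' : (toPerm s).1 = n :=
      (toPerm_fst _).trans (BinaryTree.mem_treesOfNumNodesEq.1 (Finset.mem_filter.1 hs).1)
    have ht' : (toPerm t).1 = n :=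
      (toPerm_fst _).trans (BinaryTree.mem_treesOfNumNodesEq.1 (Finset.mem_filter.1 ht).1)
    refine Subtype.ext (toPerm_injective ?_)
    have h' : hs' ▸ (toPerm s).2 = ht' ▸ (toPerm t).2 := congrArg Subtype.val h
    clear h
    change toPerm s = toPerm t
    generalize toPerm s = p at *
    generalize toPerm t = q at *
    obtain ⟨m, p⟩ := p
    obtain ⟨m', q⟩ := q
    subst hs'
    obtain rfl : m' = m := ht'
    exact congrArg _ h'
  · rintro ⟨σ, hσ, hψ⟩
    obtain ⟨t, ht⟩ := exists_toPerm_eq (p := ⟨n, σ⟩) hσ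
    have htn : t.numNodes = n := by rw [← toPerm_fst, ht]
    refine ⟨⟨t, Finset.mem_filter.2 ⟨BinaryTree.mem_treesOfNumNodesEq.2 htn, ?_⟩⟩, Subtype.ext ?_⟩
    · change Sat (toPerm t).2 ψ
      rw [ht]; exact hψ
    · dsimp only
      generalize_proofs hn
      revert hn
      rw [ht]
      exact fun _ => rfl

end Permutations

section Games

/-- A set of pairs of positions that preserves and reflects both orders. -/
def PartialIso (p q : FinPerm) (R : Set (ℕ × ℕ)) : Prop :=
  ∀ x ∈ R, x.1 < p.1 ∧ x.2 < q.1 ∧ ∀ y ∈ R, (x.1 < y.1 ↔ x.2 < y.2) ∧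
    (val p x.1 < val p y.1 ↔ val q x.2 < val q y.2)

/-- Duplicator wins the `k`-round Ehrenfeucht–Fraïssé game on `p` and `q` from the pebbles `R`. -/
def Duplicator (p q : FinPerm) : ℕ → Set (ℕ × ℕ) → Prop
  | 0, R => PartialIso p q R
  | k + 1, R => Duplicator p q k R ∧
      (∀ a < p.1, ∃ b < q.1, Duplicator p q k (insert (a, b) R)) ∧
      ∀ b < q.1, ∃ a < p.1, Duplicator p q k (insert (a, b) R)

theorem Duplicator.partialIso {p q : FinPerm} {k : ℕ} {R : Set (ℕ × ℕ)}
    (h : Duplicator p q k R) : PartialIso p q R := by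
  induction k with
  | zero => exact h
  | succ k ih => exact ih h.1

/-- The finite set of possible rank-`k` types of `m`-tuples. -/
def RankType : ℕ → ℕ → Type
  | 0, m => Fin m → Fin m → Prop × Prop
  | k + 1, m => RankType k m × Set (RankType k (m + 1))

instance finite_rankType (k m : ℕ) : Finite (RankType k m) := by
  induction k generalizing m with
  | zero => unfold RankType; infer_instance
  | succ k ih =>
    have := ih m
    have := ih (m + 1)
    unfold RankType
    infer_instance

/-- The rank-`k` type of an `m`-tuple of positions of a permutation. -/
def rankType (p : FinPerm) : ∀ k m, (Fin m → ℕ) → RankType k m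
  | 0, _, v => fun i j => (v i < v j, val p (v i) < val p (v j))
  | k + 1, m, v => (rankType p k m v, {τ | ∃ a < p.1, rankType p k (m + 1) (Fin.cons a v) = τ})

theorem range_cons_pair {m : ℕ} (a b : ℕ) (v w : Fin m → ℕ) :
    (Set.range fun i => ((Fin.cons a v : Fin (m + 1) → ℕ) i, (Fin.cons b w : Fin (m + 1) → ℕ) i)) =
      insert (a, b) (Set.range fun i => (v i, w i)) := by
  ext x
  simp [Fin.exists_fin_succ, eq_comm]

theorem rankType_eq_iff {p q : FinPerm} (k : ℕ) {m : ℕ} {v w : Fin m → ℕ} (hv : ∀ i, v i < p.1)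
    (hw : ∀ i, w i < q.1) : rankType p k m v = rankType q k m w ↔
      Duplicator p q k (Set.range fun i => (v i, w i)) := by
  induction k generalizing m with
  | zero =>
    simp only [Duplicator, PartialIso, Set.forall_mem_range]
    refine ⟨fun h i => ⟨hv i, hw i, fun j => ?_⟩, fun h => funext fun i => funext fun j => ?_⟩
    · have := congrFun (congrFun h i) j
      exact ⟨(congrArg Prod.fst this).to_iff, (congrArg Prod.snd this).to_iff⟩
    · exact Prod.ext (propext ((h i).2.2 j).1) (propext ((h i).2.2 j).2)
  | succ k ih =>
    have key : ∀ a < p.1, ∀ b < q.1, (rankType p k (m + 1) (Fin.cons a v) =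
        rankType q k (m + 1) (Fin.cons b w) ↔
        Duplicator p q k (insert (a, b) (Set.range fun i => (v i, w i)))) := by
      intro a ha b hb
      rw [ih (Fin.cases ha hv) (Fin.cases hb hw), range_cons_pair]
    rw [Duplicator, ← ih hv hw]
    refine Prod.mk_inj.trans (and_congr_right fun _ => ?_)
    rw [Set.Subset.antisymm_iff]
    refine and_congr ?_ ?_
    · constructor
      · intro h a ha
        obtain ⟨b, hb, hab⟩ := h ⟨a, ha, rfl⟩
        exact ⟨b, hb, (key a ha b hb).1 hab.symm⟩
      · rintro h _ ⟨a, ha, rfl⟩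
        obtain ⟨b, hb, hab⟩ := h a ha
        exact ⟨b, hb, ((key a ha b hb).2 hab).symm⟩
    · constructor
      · intro h b hb
        obtain ⟨a, ha, hab⟩ := h ⟨b, hb, rfl⟩
        exact ⟨a, ha, (key a ha b hb).1 hab⟩
      · rintro h _ ⟨b, hb, rfl⟩
        obtain ⟨a, ha, hab⟩ := h b hb
        exact ⟨a, ha, (key a ha b hb).2 hab⟩

theorem duplicator_refl (p : FinPerm) (k : ℕ) : Duplicator p p k ∅ := by
  have := (rankType_eq_iff (p := p) (q := p) k (v := ![]) (w := ![]) (by simp) (by simp)).1 rfl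
  rwa [Set.range_eq_empty] at this

theorem duplicator_refl_singleton (p : FinPerm) (k : ℕ) {x : ℕ} (hx : x < p.1) :
    Duplicator p p k {(x, x)} := by
  have := (rankType_eq_iff (p := p) (q := p) k (v := fun _ : Fin 1 => x) (w := fun _ => x)
    (by simpa) (by simpa)).1 rfl
  rwa [Set.range_const] at this

/-- Composition of winning strategies for an operation on permutations that juxtaposes positions
and compares the values of its two arguments uniformly. -/
theorem Duplicator.juxtapose {op : FinPerm → FinPerm → FinPerm} {c d : Prop}
    (hsize : ∀ p q, (op p q).1 = p.1 + q.1)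
    (hl : ∀ p q i j, i < p.1 → j < p.1 → (val (op p q) i < val (op p q) j ↔ val p i < val p j))
    (hr : ∀ p q i j, i < q.1 → j < q.1 →
      (val (op p q) (p.1 + i) < val (op p q) (p.1 + j) ↔ val q i < val q j))
    (hlr : ∀ p q i j, i < p.1 → j < q.1 → (val (op p q) i < val (op p q) (p.1 + j) ↔ c))
    (hrl : ∀ p q i j, i < p.1 → j < q.1 → (val (op p q) (p.1 + j) < val (op p q) i ↔ d))
    {p p' q q' : FinPerm} {k : ℕ} {R S : Set (ℕ × ℕ)} (hR : Duplicator p p' k R)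
    (hS : Duplicator q q' k S) : Duplicator (op p q) (op p' q') k
      (R ∪ (fun x => (p.1 + x.1, p'.1 + x.2)) '' S) := by
  induction k generalizing R S with
  | zero =>
    have hR' : PartialIso p p' R := hR
    have hS' : PartialIso q q' S := hS
    rintro x (hx | ⟨x, hx, rfl⟩)
    · obtain ⟨h1, h2, h3⟩ := hR' x hx
      refine ⟨by rw [hsize]; omega, by rw [hsize]; omega, ?_⟩
      rintro y (hy | ⟨y, hy, rfl⟩)
      · obtain ⟨h4, h5, -⟩ := hR' y hy
        rw [hl _ _ _ _ h1 h4, hl _ _ _ _ h2 h5]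
        exact h3 y hy
      · obtain ⟨h4, h5, -⟩ := hS' y hy
        dsimp only
        rw [hlr _ _ _ _ h1 h4, hlr _ _ _ _ h2 h5]
        exact ⟨by omega, Iff.rfl⟩
    · obtain ⟨h1, h2, h3⟩ := hS' x hx
      dsimp only
      refine ⟨by rw [hsize]; omega, by rw [hsize]; omega, ?_⟩
      rintro y (hy | ⟨y, hy, rfl⟩)
      · obtain ⟨h4, h5, -⟩ := hR' y hy
        rw [hrl _ _ _ _ h4 h1, hrl _ _ _ _ h5 h2]
        exact ⟨by omega, Iff.rfl⟩
      · obtain ⟨h4, h5, -⟩ := hS' y hy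
        dsimp only
        rw [hr _ _ _ _ h1 h4, hr _ _ _ _ h2 h5]
        have := h3 y hy
        exact ⟨by omega, this.2⟩
  | succ k ih =>
    obtain ⟨hR0, hR1, hR2⟩ := hR
    obtain ⟨hS0, hS1, hS2⟩ := hS
    refine ⟨ih hR0 hS0, fun a ha => ?_, fun b hb => ?_⟩
    · rw [hsize] at ha ⊢
      rcases lt_or_ge a p.1 with h | h
      · obtain ⟨b, hb, hab⟩ := hR1 a h
        refine ⟨b, by omega, ?_⟩
        rw [← Set.insert_union]
        exact ih hab hS0
      · obtain ⟨a, rfl⟩ := Nat.exists_eq_add_of_le h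
        obtain ⟨b, hb, hab⟩ := hS1 a (by omega)
        refine ⟨p'.1 + b, by omega, ?_⟩
        have := ih hR0 hab
        rwa [Set.image_insert_eq, Set.union_insert] at this
    · rw [hsize] at hb ⊢
      rcases lt_or_ge b p'.1 with h | h
      · obtain ⟨a, ha, hab⟩ := hR2 b h
        refine ⟨a, by omega, ?_⟩
        rw [← Set.insert_union]
        exact ih hab hS0
      · obtain ⟨b, rfl⟩ := Nat.exists_eq_add_of_le h
        obtain ⟨a, ha, hab⟩ := hS2 b (by omega)
        refine ⟨p.1 + a, by omega, ?_⟩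
        have := ih hR0 hab
        rwa [Set.image_insert_eq, Set.union_insert] at this

theorem Duplicator.mul {p p' q q' : FinPerm} {k : ℕ} {R S : Set (ℕ × ℕ)}
    (hR : Duplicator p p' k R) (hS : Duplicator q q' k S) :
    Duplicator (p * q) (p' * q') k (R ∪ (fun x => (p.1 + x.1, p'.1 + x.2)) '' S) := by
  refine Duplicator.juxtapose (op := (· * ·)) (c := True) (d := False) mul_fst ?_ ?_ ?_ ?_ hR hS
  · intro p q i j hi hj
    rw [val_mul_left q hi, val_mul_left q hj]
  · intro p q i j hi hj
    rw [val_mul_right p hi, val_mul_right p hj]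
    omega
  · intro p q i j hi hj
    rw [val_mul_left q hi, val_mul_right p hj, iff_true]
    have := val_lt hi
    omega
  · intro p q i j hi hj
    rw [val_mul_left q hi, val_mul_right p hj, iff_false]
    have := val_lt hi
    omega

theorem Duplicator.skew {p p' q q' : FinPerm} {k : ℕ} {R S : Set (ℕ × ℕ)}
    (hR : Duplicator p p' k R) (hS : Duplicator q q' k S) :
    Duplicator (skew p q) (skew p' q') k (R ∪ (fun x => (p.1 + x.1, p'.1 + x.2)) '' S) := by
  refine Duplicator.juxtapose (op := Av231.skew) (c := False) (d := True) skew_fst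
    ?_ ?_ ?_ ?_ hR hS
  · intro p q i j hi hj
    rw [val_skew_left q hi, val_skew_left q hj]
    omega
  · intro p q i j hi hj
    rw [val_skew_right p hi, val_skew_right p hj]
  · intro p q i j hi hj
    rw [val_skew_left q hi, val_skew_right p hj, iff_false]
    have := val_lt hj
    omega
  · intro p q i j hi hj
    rw [val_skew_left q hi, val_skew_right p hj, iff_true]
    have := val_lt hj
    omega

theorem Duplicator.glue {p p' q q' : FinPerm} {k : ℕ} (hp : Duplicator p p' k ∅)
    (hq : Duplicator q q' k ∅) : Duplicator (glue p q) (glue p' q') k ∅ := by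
  have := hp.mul ((duplicator_refl ⟨1, 1⟩ k).skew hq)
  simpa [glue_eq] using this

theorem pow_fst (p : FinPerm) (m : ℕ) : (p ^ m).1 = m * p.1 := by
  induction m with
  | zero => simp
  | succ m ih => rw [pow_succ, mul_fst, ih, Nat.succ_mul]

/-- Powers with large exponents cannot be distinguished with few quantifiers. -/
theorem duplicator_pow (p : FinPerm) (k : ℕ) {m n : ℕ} (hm : 2 ^ k ≤ m + 1) (hn : 2 ^ k ≤ n + 1) :
    Duplicator (p ^ m) (p ^ n) k ∅ := by
  induction k generalizing m n with
  | zero => intro x hx; simp at hx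
  | succ k ih =>
    have hk : 1 ≤ 2 ^ k := Nat.one_le_two_pow
    rw [pow_succ] at hm hn
    have equal_or_large : ∀ {i i' : ℕ}, (i = i' ∨ 2 ^ k ≤ i + 1 ∧ 2 ^ k ≤ i' + 1) →
        Duplicator (p ^ i) (p ^ i') k ∅ := by
      rintro i i' (rfl | ⟨h1, h2⟩)
      · exact duplicator_refl _ _
      · exact ih h1 h2
    have core : ∀ {i i' j j' x : ℕ}, (i = i' ∨ 2 ^ k ≤ i + 1 ∧ 2 ^ k ≤ i' + 1) →
        (j = j' ∨ 2 ^ k ≤ j + 1 ∧ 2 ^ k ≤ j' + 1) → x < p.1 →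
        Duplicator (p ^ (i + 1 + j)) (p ^ (i' + 1 + j')) k {(i * p.1 + x, i' * p.1 + x)} := by
      intro i i' j j' x hi hj hx
      have := ((equal_or_large hi).mul (duplicator_refl_singleton p k hx)).mul (equal_or_large hj)
      rw [← pow_succ, ← pow_succ, ← pow_add, ← pow_add] at this
      simpa [pow_fst] using this
    have choose_index : ∀ {m n i : ℕ}, 2 ^ k * 2 ≤ m + 1 → 2 ^ k * 2 ≤ n + 1 → i < m →
        ∃ i' < n, (i = i' ∨ 2 ^ k ≤ i + 1 ∧ 2 ^ k ≤ i' + 1) ∧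
          (m - 1 - i = n - 1 - i' ∨ 2 ^ k ≤ m - 1 - i + 1 ∧ 2 ^ k ≤ n - 1 - i' + 1) := by
      intro m n i hm hn hi
      by_cases h1 : i + 1 < 2 ^ k
      · exact ⟨i, by omega, by omega, by omega⟩
      · by_cases h2 : m - 1 - i + 1 < 2 ^ k
        · exact ⟨n - 1 - (m - 1 - i), by omega, by omega, by omega⟩
        · exact ⟨2 ^ k - 1, by omega, by omega, by omega⟩
    have locate : ∀ {m a : ℕ}, a < (p ^ m).1 → a / p.1 < m ∧ a % p.1 < p.1 ∧
        a / p.1 * p.1 + a % p.1 = a := by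
      intro m a ha
      rw [pow_fst] at ha
      have hp : 0 < p.1 := Nat.pos_of_ne_zero fun h => by simp [h] at ha
      exact ⟨(Nat.div_lt_iff_lt_mul hp).2 ha, Nat.mod_lt _ hp, Nat.div_add_mod' _ _⟩
    have bound : ∀ {n i x : ℕ}, i < n → x < p.1 → i * p.1 + x < (p ^ n).1 := by
      intro n i x hi hx
      rw [pow_fst]
      calc i * p.1 + x < (i + 1) * p.1 := by rw [Nat.succ_mul]; omega
        _ ≤ n * p.1 := Nat.mul_le_mul_right _ hi
    refine ⟨ih (by omega) (by omega), fun a ha => ?_, fun b hb => ?_⟩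
    · obtain ⟨h1, h2, h3⟩ := locate ha
      obtain ⟨i', hi', h4, h5⟩ := choose_index hm hn h1
      refine ⟨i' * p.1 + a % p.1, bound hi' h2, ?_⟩
      have := core h4 h5 h2
      rw [← insert_empty_eq] at this
      rwa [show a / p.1 + 1 + (m - 1 - a / p.1) = m by omega,
        show i' + 1 + (n - 1 - i') = n by omega, h3] at this
    · obtain ⟨h1, h2, h3⟩ := locate hb
      obtain ⟨i, hi, h4, h5⟩ := choose_index hn hm h1
      refine ⟨i * p.1 + b % p.1, bound hi h2, ?_⟩
      have := core (i := i) (i' := b / p.1) (j := m - 1 - i) (j' := n - 1 - b / p.1)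
        (by omega) (by omega) h2
      rw [← insert_empty_eq] at this
      rwa [show b / p.1 + 1 + (n - 1 - b / p.1) = n by omega,
        show i + 1 + (m - 1 - i) = m by omega, h3] at this

theorem exists_eq_var {n : ℕ} (t : L.Term (Empty ⊕ Fin n)) :
    ∃ i, t = Language.Term.var (Sum.inr i) := by
  cases t with
  | var x =>
    rcases x with x | i
    · exact x.elim
    · exact ⟨i, rfl⟩
  | func f _ => exact Empty.elim f

theorem Duplicator.realize_iff {p q : FinPerm} {n : ℕ} (φ : L.BoundedFormula Empty n) {k : ℕ}
    {R : Set (ℕ × ℕ)} {xs : Fin n → Fin p.1} {ys : Fin n → Fin q.1} (hφ : qd φ ≤ k)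
    (hxy : ∀ i, ((xs i : ℕ), (ys i : ℕ)) ∈ R) (h : Duplicator p q k R) :
    @Language.BoundedFormula.Realize L (Fin p.1) (pStruct p.2) Empty n φ default xs ↔
      @Language.BoundedFormula.Realize L (Fin q.1) (pStruct q.2) Empty n φ default ys := by
  let _ := pStruct p.2
  let _ := pStruct q.2
  induction φ generalizing k R with
  | falsum => exact Iff.rfl
  | equal t u =>
    obtain ⟨i, rfl⟩ := exists_eq_var t
    obtain ⟨j, rfl⟩ := exists_eq_var u
    simp only [Language.BoundedFormula.Realize, Language.Term.realize_var, Sum.elim_inr,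
      Fin.ext_iff]
    have h1 := ((h.partialIso _ (hxy i)).2.2 _ (hxy j)).1
    have h2 := ((h.partialIso _ (hxy j)).2.2 _ (hxy i)).1
    simp only at h1 h2
    omega
  | rel r ts =>
    have h1 : ∀ i j, ((xs i : ℕ) < xs j ↔ (ys i : ℕ) < ys j) ∧
        ((p.2 (xs i) : ℕ) < p.2 (xs j) ↔ (q.2 (ys i) : ℕ) < q.2 (ys j)) := by
      intro i j
      have := (h.partialIso _ (hxy i)).2.2 _ (hxy j)
      simpa only [val_of_lt (Fin.isLt _)] using this
    cases r with
    | lp =>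
      obtain ⟨i, hi⟩ := exists_eq_var (ts 0)
      obtain ⟨j, hj⟩ := exists_eq_var (ts 1)
      change (ts 0).realize _ < (ts 1).realize _ ↔ (ts 0).realize _ < (ts 1).realize _
      rw [hi, hj]
      exact (h1 i j).1
    | lv =>
      obtain ⟨i, hi⟩ := exists_eq_var (ts 0)
      obtain ⟨j, hj⟩ := exists_eq_var (ts 1)
      change p.2 ((ts 0).realize _) < p.2 ((ts 1).realize _) ↔
        q.2 ((ts 0).realize _) < q.2 ((ts 1).realize _)
      rw [hi, hj]
      exact (h1 i j).2
  | imp f g ihf ihg =>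
    rw [qd] at hφ
    exact imp_congr (ihf (le_trans (le_max_left _ _) hφ) hxy h)
      (ihg (le_trans (le_max_right _ _) hφ) hxy h)
  | all f ih =>
    rw [qd] at hφ
    obtain ⟨k, rfl⟩ : ∃ l, k = l + 1 := ⟨k - 1, by omega⟩
    obtain ⟨-, h1, h2⟩ := h
    rw [Language.BoundedFormula.realize_all, Language.BoundedFormula.realize_all]
    have extend : ∀ (a : Fin p.1) (b : Fin q.1), Duplicator p q k (insert ((a : ℕ), (b : ℕ)) R) →
        (f.Realize default (Fin.snoc xs a) ↔ f.Realize default (Fin.snoc ys b)) := by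
      intro a b hab
      refine ih (by omega) (fun i => ?_) hab
      refine Fin.lastCases ?_ (fun i => ?_) i
      · simp
      · simp [hxy i]
    constructor
    · intro H b
      obtain ⟨a, ha, hab⟩ := h2 b b.isLt
      exact (extend ⟨a, ha⟩ b hab).1 (H _)
    · intro H a
      obtain ⟨b, hb, hab⟩ := h1 a a.isLt
      exact (extend a ⟨b, hb⟩ hab).2 (H _)

theorem Duplicator.sat_iff {p q : FinPerm} {ψ : L.Sentence} (h : Duplicator p q (qd ψ) ∅) :
    Sat p.2 ψ ↔ Sat q.2 ψ :=
  h.realize_iff ψ le_rfl (fun i => i.elim0)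

end Games

section Algebra

/-- An aperiodic finite monoid contains an element `e` with `e * x * e = e` for all `x`. -/
theorem exists_mul_mul_eq_self {M : Type*} [Monoid M] [Finite M] {N : ℕ}
    (hN : ∀ x : M, x ^ (N + 1) = x ^ N) : ∃ e : M, ∀ x, e * x * e = e := by
  obtain ⟨s, hs⟩ : ∃ s : M, ∀ y, ∃ a b, s = a * y * b := by
    have := Fintype.ofFinite M
    refine ⟨(Finset.univ : Finset M).toList.prod, fun y => ?_⟩
    obtain ⟨u, v, huv⟩ := List.append_of_mem (Finset.mem_toList.2 (Finset.mem_univ y))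
    exact ⟨u.prod, v.prod, by rw [huv]; simp [mul_assoc]⟩
  have hpow : ∀ (x : M) (n : ℕ), x ^ (N + n) = x ^ N := by
    intro x n
    induction n with
    | zero => rfl
    | succ n ih => rw [← add_assoc, pow_succ, ih, ← pow_succ, hN]
  set e := s ^ (N + 1) with he
  have hee : e * e = e := by
    rw [he, ← pow_add, show N + 1 + (N + 1) = N + (N + 2) by omega, hpow, hN]
  -- A one-sided inverse pair relative to `e` is trivial.
  have unit : ∀ a b : M, e * b = b → a * e = a → a * b = e → b = e := by
    intro a b hb ha hab
    have hN' : ∀ n : ℕ, a ^ n * (e * b ^ n) = e := by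
      intro n
      induction n with
      | zero => simp
      | succ n ih =>
        calc a ^ (n + 1) * (e * b ^ (n + 1)) = a ^ n * ((a * e) * b * b ^ n) := by
              rw [pow_succ, pow_succ']; simp only [mul_assoc]
          _ = e := by rw [ha, hab, ih]
    calc b = e * b := hb.symm
      _ = a ^ N * (e * b ^ N) * b := by rw [hN']
      _ = a ^ N * (e * b ^ (N + 1)) := by rw [pow_succ]; simp only [mul_assoc]
      _ = e := by rw [hN, hN']
  refine ⟨e, fun x => ?_⟩
  obtain ⟨a, b, hab⟩ := hs (e * x * e)
  have hl : ∀ z, e * (e * z) = e * z := fun z => by rw [← mul_assoc, hee]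
  have h : e * a * e * (e * x * e) * (e * (b * s ^ N) * e) = e := by
    calc _ = e * (a * (e * x * e) * b * s ^ N) * e := by simp only [mul_assoc, hl]
      _ = e := by rw [← hab, ← pow_succ', ← he, hee, hee]
  have h1 := unit _ _ (by simp only [mul_assoc, hl]) (by simp only [mul_assoc, hee]) h
  refine unit (e * a * e) _ (by simp only [mul_assoc, hl]) (by simp only [mul_assoc, hee]) ?_
  rw [h1] at h
  simpa only [mul_assoc, hee, hl] using h

end Algebra

section ConvergenceLaw

instance : Monoid (BinaryTree Unit) where
  mul := graft
  one := .nil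
  mul_assoc x y z := by
    change graft (graft x y) z = graft x (graft y z)
    induction z with
    | nil => rfl
    | node _ l r hl _ => simp only [graft, hl]
  one_mul x := by
    change graft .nil x = x
    induction x with
    | nil => rfl
    | node _ l r hl _ => simp only [graft, hl]
  mul_one _ := rfl

/-- `toPerm` turns grafting of trees into direct sums. -/
def toPermHom : BinaryTree Unit →* FinPerm where
  toFun := toPerm
  map_one' := rfl
  map_mul' x y := by
    change toPerm (graft x y) = toPerm x * toPerm y
    induction y with
    | nil => exact (mul_one _).symm
    | node _ l r hl _ => rw [graft, toPerm, hl, toPerm, glue_eq, glue_eq, mul_assoc]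

/-- The rank-`k` type of the permutation encoded by a tree. -/
def treeType (k : ℕ) (t : BinaryTree Unit) : RankType k 0 := rankType (toPermHom t) k 0 ![]

theorem treeType_eq_iff {k : ℕ} {s t : BinaryTree Unit} :
    treeType k s = treeType k t ↔ Duplicator (toPermHom s) (toPermHom t) k ∅ := by
  rw [treeType, treeType, rankType_eq_iff k (by simp) (by simp), Set.range_eq_empty]

theorem treeType_node {k : ℕ} {s s' t t' : BinaryTree Unit} (hs : treeType k s = treeType k s')
    (ht : treeType k t = treeType k t') :
    treeType k (.node () s t) = treeType k (.node () s' t') := by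
  rw [treeType_eq_iff] at *
  exact hs.glue ht

/-- Equality of rank-`k` types as a congruence on trees. -/
def typeCon (k : ℕ) : Con (BinaryTree Unit) where
  toSetoid := Setoid.ker (treeType k)
  mul' {w x y z} h1 h2 := by
    simp only [Setoid.ker_def, treeType_eq_iff, map_mul] at *
    simpa using h1.mul h2

/-- Some tree absorbs, up to rank-`k` type, every tree placed between two copies of it. -/
theorem exists_absorbing_tree (k : ℕ) :
    ∃ e : BinaryTree Unit, ∀ x, treeType k (e * x * e) = treeType k e := by
  have : Finite (typeCon k).Quotient :=
    Finite.of_injective (Quotient.lift (treeType k) fun _ _ h => h) fun a b =>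
      Quotient.inductionOn₂ a b fun _ _ h => Quotient.sound h
  obtain ⟨e, he⟩ := exists_mul_mul_eq_self (M := (typeCon k).Quotient) (N := 2 ^ k) fun x => by
    induction x using Con.induction_on with
    | H t =>
      have h : treeType k (t ^ (2 ^ k + 1)) = treeType k (t ^ 2 ^ k) := by
        rw [treeType_eq_iff, map_pow, map_pow]
        exact duplicator_pow _ k (by omega) (by omega)
      exact (Con.eq (typeCon k)).2 h
  induction e using Con.induction_on with
  | H e => exact ⟨e, fun x => (Con.eq _).1 (he x)⟩

/-- The class of 231-avoiding permutations satisfies a first-order convergence law: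
for every first-order sentence `ψ` in the language of two orders, the probability that a
uniform random 231-avoiding permutation of size `n` satisfies `ψ` converges as `n → ∞`. -/
theorem convergence_law (ψ : L.Sentence) :
    ∃ l : ℝ, Tendsto (fun n : ℕ => prob n ψ) atTop (𝓝 l) := by
  have hprob : ∀ n, prob n ψ = treeFreq n {t | Sat (toPerm t).2 ψ} := fun n => by
    rw [prob, treeFreq, avN_eq_treeCount]
  simp_rw [hprob]
  obtain ⟨e, he⟩ := exists_absorbing_tree (qd ψ)
  let F : Set (Set (BinaryTree Unit)) :=
    {U | ∀ s t, treeType (qd ψ) s = treeType (qd ψ) t → s ∈ U → t ∈ U}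
  have hF : F.Finite := by
    refine (Set.finite_range fun W : Set (RankType (qd ψ) 0) =>
      {t | treeType (qd ψ) t ∈ W}).subset fun U hU => ⟨treeType (qd ψ) '' U, ?_⟩
    ext t
    exact ⟨fun ⟨s, hs, hst⟩ => hU s t hst hs, fun ht => ⟨t, ht, rfl⟩⟩
  refine exists_tendsto_treeFreq hF (e := e) (fun U hU s x y hxy => ?_) (fun U hU s x y hxy => ?_)
    (fun U hU x y => ?_) (U := {t | Sat (toPerm t).2 ψ}) fun s t hst => ?_
  · exact hU _ _ (treeType_node rfl hxy)
  · exact hU _ _ (treeType_node hxy rfl)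
  · have hgraft : ∀ x, graft (.node () e x) e = e * .node () .nil x * e := fun _ => rfl
    exact hU _ _ (by rw [hgraft, hgraft, he, he])
  · exact (treeType_eq_iff.1 hst).sat_iff.1

end ConvergenceLaw

end Av231
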